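/- For every field k, every n ≥ 1 and every dimension vector d = (d_i)_{i∈ℤ/nℤ}, the action of G_d = ∏_{i∈ℤ/nℤ} GL_{d_i}(k) on the nilpotent representation space E_nilp(d) of the cyclic quiver Δ_n^{(1)} has only finitely many orbits. -/

import Mathlib

open Module LinearMap Finset

/-- The vertex of the cyclic quiver reached from vertex `i` after `t` steps. -/
def vtx (n : ℕ) (i : ZMod n) : ℕ → ZMod n
  | 0 => i
  | t + 1 => vtx n i t + 1

/-- The composition `φ_{i+t-1} ∘ ⋯ ∘ φ_{i+1} ∘ φ_i` of `t` consecutive structure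
maps of a representation of the cyclic quiver, starting at vertex `i`. -/
def ccomps {k : Type*} [Field k] {n : ℕ} (d : ZMod n → ℕ)
    (φ : ∀ i : ZMod n, (Fin (d i) → k) →ₗ[k] (Fin (d (i + 1)) → k)) (i : ZMod n) :
    ∀ t : ℕ, (Fin (d i) → k) →ₗ[k] (Fin (d (vtx n i t)) → k)
  | 0 => LinearMap.id
  | t + 1 => (φ (vtx n i t)).comp (ccomps d φ i t)

/-- A representation of the cyclic quiver is nilpotent:
`φ_{i+N-1} ∘ ⋯ ∘ φ_i = 0` for all `i` and all sufficiently large `N`. -/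
def IsNilpotentRep {k : Type*} [Field k] {n : ℕ} (d : ZMod n → ℕ)
    (φ : ∀ i : ZMod n, (Fin (d i) → k) →ₗ[k] (Fin (d (i + 1)) → k)) : Prop :=
  ∃ N₀ : ℕ, ∀ (i : ZMod n) (N : ℕ), N₀ ≤ N → ccomps d φ i N = 0

/-- Two points of the representation space of the cyclic quiver lie in the same
orbit of `G_d = ∏_{i ∈ ℤ/nℤ} GL_{dᵢ}(k)`, acting by `(g·φ)ᵢ = gᵢ₊₁ ∘ φᵢ ∘ gᵢ⁻¹`. -/
def sameOrbitC (k : Type*) [Field k] {n : ℕ} (d : ZMod n → ℕ)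
    (φ ψ : ∀ i : ZMod n, (Fin (d i) → k) →ₗ[k] (Fin (d (i + 1)) → k)) : Prop :=
  ∃ g : ∀ i : ZMod n, (Fin (d i) → k) ≃ₗ[k] (Fin (d i) → k),
    ∀ i, ψ i = (g (i + 1)).toLinearMap ∘ₗ φ i ∘ₗ ((g i).symm).toLinearMap

/-- The elements of `V i` killed by `t` successive maps of a representation `φ` along `σ`. -/
def iterKer {k ι : Type*} [Field k] {V : ι → Type*} [∀ i, AddCommGroup (V i)]
    [∀ i, Module k (V i)] {σ : ι → ι} (φ : ∀ i, V i →ₗ[k] V (σ i)) :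
    ℕ → ∀ i, Submodule k (V i)
  | 0, _ => ⊥
  | t + 1, i => (iterKer φ t (σ i)).comap (φ i)

/-- A set linearly independent modulo `U` extends, inside `K`, to a set which together with `U`
spans `K`. -/
lemma exists_extension_mod {k V : Type*} [Field k] [AddCommGroup V] [Module k V]
    {U K : Submodule k V} (hUK : U ≤ K) {A : Set V} (hA : A ⊆ K)
    (hind : LinearIndepOn k U.mkQ A) :
    ∃ C : Set V, C ⊆ K ∧ A ⊆ C ∧ LinearIndepOn k U.mkQ C ∧ U ⊔ Submodule.span k C = K := by
  obtain ⟨C, hCK, hAC, hspan, hC⟩ := exists_linearIndepOn_extension hind hA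
  refine ⟨C, hCK, hAC, hC, le_antisymm (sup_le hUK (Submodule.span_le.2 hCK)) fun x hx => ?_⟩
  have h := hspan ⟨x, hx, rfl⟩
  rw [← Submodule.map_span, SetLike.mem_coe] at h
  obtain ⟨y, hy, hyx⟩ := h
  rw [Submodule.mkQ_apply, Submodule.mkQ_apply, Submodule.Quotient.eq] at hyx
  have : x = -(y - x) + y := by abel
  rw [this]
  exact add_mem (Submodule.mem_sup_left (neg_mem hyx)) (Submodule.mem_sup_right hy)

/-- Linear independence modulo the preimage of `U` is preserved by taking images. -/
lemma linearIndepOn_mkQ_image {k V W : Type*} [Field k] [AddCommGroup V] [Module k V]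
    [AddCommGroup W] [Module k W] (f : V →ₗ[k] W) (U : Submodule k W) {C : Set V}
    (hC : LinearIndepOn k (U.comap f).mkQ C) : LinearIndepOn k U.mkQ (f '' C) := by
  apply LinearIndepOn.image_of_comp
  have h := LinearIndependent.map' hC ((U.comap f).mapQ U f le_rfl) (by
    rw [Submodule.ker_mapQ, Submodule.mkQ_map_self])
  exact h

section

variable {k ι : Type*} [Field k] {V : ι → Type*} [∀ i, AddCommGroup (V i)]
  [∀ i, Module k (V i)] {σ : ι → ι}

lemma iterKer_le_succ (φ : ∀ i, V i →ₗ[k] V (σ i)) (t : ℕ) (i : ι) :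
    iterKer φ t i ≤ iterKer φ (t + 1) i := by
  induction t generalizing i with
  | zero => exact bot_le
  | succ t ih => exact Submodule.comap_mono (ih (σ i))

/-- A set independent modulo `iterKer φ t` extends to a basis of `iterKer φ (t + 1)` which `φ`
maps into itself together with zero. -/
lemma exists_adapted_sets (φ : ∀ i, V i →ₗ[k] V (σ i)) (hσ : Function.Bijective σ) (t : ℕ)
    (A : ∀ i, Set (V i)) (hA : ∀ i, A i ⊆ iterKer φ (t + 1) i)
    (hind : ∀ i, LinearIndepOn k (iterKer φ t i).mkQ (A i)) :
    ∃ S : ∀ i, Set (V i), (∀ i, A i ⊆ S i) ∧ (∀ i, LinearIndepOn k id (S i)) ∧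
      (∀ i, Submodule.span k (S i) = iterKer φ (t + 1) i) ∧
      ∀ i, ∀ x ∈ S i, φ i x = 0 ∨ φ i x ∈ S (σ i) := by
  induction t generalizing A with
  | zero =>
    choose C hCK hAC hC hspan using fun i =>
      exists_extension_mod (iterKer_le_succ φ 0 i) (hA i) (hind i)
    refine ⟨C, hAC, fun i => ?_, fun i => ?_, fun i x hx => Or.inl ?_⟩
    · exact LinearIndependent.of_comp (iterKer φ 0 i).mkQ (hC i)
    · rw [← hspan i]
      exact bot_sup_eq _ |>.symm
    · exact hCK i hx
  | succ t ih =>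
    choose C hCK hAC hC hspan using fun i =>
      exists_extension_mod (iterKer_le_succ φ (t + 1) i) (hA i) (hind i)
    have hD : ∀ i', ∃ D : Set (V i'), D ⊆ iterKer φ (t + 1) i' ∧
        LinearIndepOn k (iterKer φ t i').mkQ D ∧
        ∀ i (h : σ i = i'), ∀ x ∈ C i, h ▸ φ i x ∈ D := by
      intro i'
      obtain ⟨i, rfl⟩ := hσ.2 i'
      refine ⟨φ i '' C i, ?_, linearIndepOn_mkQ_image _ _ (hC i), ?_⟩
      · rintro _ ⟨x, hx, rfl⟩
        exact hCK i hx
      · intro j h x hx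
        obtain rfl := hσ.1 h
        exact ⟨x, hx, rfl⟩
    choose D hDK hD hCD using hD
    obtain ⟨S, hDS, hS, hSspan, hφS⟩ := ih D hDK hD
    refine ⟨fun i => S i ∪ C i, fun i => (hAC i).trans Set.subset_union_right, fun i => ?_,
      fun i => ?_, fun i x hx => ?_⟩
    · exact LinearIndepOn.union_id_of_quotient
        ((hSspan i).symm ▸ Submodule.subset_span) (hS i) (hC i)
    · rw [Submodule.span_union, hSspan, hspan]
    · rcases hx with hx | hx
      · exact (hφS i x hx).imp_right Or.inl
      · exact Or.inr (Or.inl (hDS _ (hCD _ i rfl x hx)))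

/-- A nilpotent representation has bases whose elements are mapped to basis elements or zero. -/
lemma exists_adapted_bases {d : ι → ℕ} (φ : ∀ i, V i →ₗ[k] V (σ i))
    (hσ : Function.Bijective σ) [∀ i, FiniteDimensional k (V i)]
    (hd : ∀ i, finrank k (V i) = d i) {N : ℕ} (hN : ∀ i, iterKer φ N i = ⊤) :
    ∃ b : ∀ i, Basis (Fin (d i)) k (V i),
      ∀ i j, φ i (b i j) = 0 ∨ ∃ l, φ i (b i j) = b (σ i) l := by
  obtain ⟨S, -, hS, hspan, hφ⟩ := exists_adapted_sets φ hσ N (fun _ => ∅) (by simp) (by simp)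
  have htop : ∀ i, ⊤ ≤ Submodule.span k (Set.range ((↑) : S i → V i)) := fun i => by
    rw [Subtype.range_coe, hspan, ← hN i]
    exact iterKer_le_succ φ N i
  let B : ∀ i, Basis (S i) k (V i) := fun i => Basis.mk (hS i) (htop i)
  have e : ∀ i, S i ≃ Fin (d i) := fun i => by
    have : Finite (S i) := Module.Finite.finite_basis (B i)
    have hc := Module.finrank_eq_nat_card_basis (B i)
    exact Finite.equivFinOfCardEq (by rw [← hc, hd])
  have hb : ∀ i j, (B i).reindex (e i) j = ((e i).symm j : V i) := fun i j => by simp [B]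
  refine ⟨fun i => (B i).reindex (e i), fun i j => ?_⟩
  rw [hb]
  refine (hφ i _ ((e i).symm j).2).imp_right fun h => ⟨e _ ⟨_, h⟩, ?_⟩
  rw [hb, Equiv.symm_apply_apply]

end

section

variable {k : Type*} [Field k] {n : ℕ} {d : ZMod n → ℕ}

lemma mem_iterKer_iff (φ : ∀ i : ZMod n, (Fin (d i) → k) →ₗ[k] (Fin (d (i + 1)) → k))
    (t : ℕ) (i : ZMod n) (x : Fin (d i) → k) :
    x ∈ iterKer (σ := fun i => i + 1) φ t i ↔ ccomps d φ i t x = 0 := by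
  let Φ : (Σ i, Fin (d i) → k) → Σ i, Fin (d i) → k := fun p => ⟨p.1 + 1, φ p.1 p.2⟩
  have h₁ : ∀ t i x, Φ^[t] ⟨i, x⟩ = ⟨vtx n i t, ccomps d φ i t x⟩ := by
    intro t i x
    induction t with
    | zero => rfl
    | succ t ih => rw [Function.iterate_succ_apply', ih]; rfl
  have h₂ : ∀ t i x, x ∈ iterKer (σ := fun i => i + 1) φ t i ↔ (Φ^[t] ⟨i, x⟩).2 = 0 := by
    intro t
    induction t with
    | zero => intro i x; rfl
    | succ t ih => intro i x; exact ih (i + 1) (φ i x)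
  rw [h₂, h₁]

lemma IsNilpotentRep.of_sameOrbitC
    {φ ψ : ∀ i : ZMod n, (Fin (d i) → k) →ₗ[k] (Fin (d (i + 1)) → k)}
    (hφ : IsNilpotentRep d φ) (h : sameOrbitC k d φ ψ) : IsNilpotentRep d ψ := by
  obtain ⟨g, hg⟩ := h
  have key : ∀ i t x, ccomps d ψ i t x = g _ (ccomps d φ i t ((g i).symm x)) := by
    intro i t x
    induction t with
    | zero => exact ((g i).apply_symm_apply x).symm
    | succ t ih =>
      change ψ _ (ccomps d ψ i t x) = g _ (φ _ (ccomps d φ i t _))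
      rw [ih, hg]
      simp
  obtain ⟨N₀, h⟩ := hφ
  exact ⟨N₀, fun i N hN => LinearMap.ext fun x => by simp [key, h i N hN]⟩

/-- The representation sending each standard basis vector to a prescribed standard basis vector,
or to zero. -/
noncomputable def partialMapRep (k : Type*) [Field k] {n : ℕ} {d : ZMod n → ℕ}
    (f : ∀ i : ZMod n, Fin (d i) → Option (Fin (d (i + 1)))) (i : ZMod n) :
    (Fin (d i) → k) →ₗ[k] (Fin (d (i + 1)) → k) :=
  (Pi.basisFun k (Fin (d i))).constr k fun j => (f i j).elim 0 fun l => Pi.single l 1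

lemma IsNilpotentRep.exists_partialMapRep
    {φ : ∀ i : ZMod n, (Fin (d i) → k) →ₗ[k] (Fin (d (i + 1)) → k)}
    (hφ : IsNilpotentRep d φ) : ∃ f, sameOrbitC k d φ (partialMapRep k f) := by
  obtain ⟨N, hN⟩ := hφ
  obtain ⟨b, hb⟩ := exists_adapted_bases (σ := fun i : ZMod n => i + 1) (d := d) φ
    (Equiv.addRight (1 : ZMod n)).bijective (by simp) (N := N)
    (fun i => eq_top_iff.2 fun x _ => by rw [mem_iterKer_iff, hN i N le_rfl]; rfl)
  have hf : ∀ i j, ∃ o : Option (Fin (d (i + 1))),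
      φ i (b i j) = o.elim 0 fun l => b (i + 1) l := fun i j => by
    rcases hb i j with h | ⟨l, h⟩
    · exact ⟨none, h⟩
    · exact ⟨some l, h⟩
  choose f hf using hf
  refine ⟨f, fun i => (b i).equivFun, fun i => (Pi.basisFun k _).ext fun j => ?_⟩
  have hs : (b i).equivFun.symm (Pi.single j 1) = b i j := by
    rw [LinearEquiv.symm_apply_eq]
    ext l
    rw [Basis.equivFun_self, Pi.single_apply]
    simp only [eq_comm]
  rw [partialMapRep, Basis.constr_basis]
  simp only [Pi.basisFun_apply, LinearMap.comp_apply, LinearEquiv.coe_coe]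
  rw [hs, hf]
  cases f i j with
  | none => simp
  | some l =>
    ext m
    simp [Pi.single_apply, eq_comm]

end

/-- For every field `k`, every `n ≥ 1` and every dimension vector
`d = (dᵢ)_{i ∈ ℤ/nℤ}`, the group `G_d` acts on the nilpotent representation
space `E_nilp(d)` of the cyclic quiver with only finitely many orbits. -/
theorem finitely_many_orbits_cyclic_quiver
    (k : Type*) [Field k] (n : ℕ) (hn : 1 ≤ n) (d : ZMod n → ℕ) :
    ∃ s : Set (∀ i : ZMod n, (Fin (d i) → k) →ₗ[k] (Fin (d (i + 1)) → k)),
      s.Finite ∧ (∀ φ ∈ s, IsNilpotentRep d φ) ∧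
      ∀ φ, IsNilpotentRep d φ → ∃ ψ ∈ s, sameOrbitC k d φ ψ := by
  have : NeZero n := ⟨by omega⟩
  refine ⟨{ψ | IsNilpotentRep d ψ ∧ ψ ∈ Set.range (partialMapRep k)},
    (Set.finite_range _).subset fun _ h => h.2, fun _ h => h.1, fun φ hφ => ?_⟩
  obtain ⟨f, hf⟩ := hφ.exists_partialMapRep
  exact ⟨_, ⟨hφ.of_sameOrbitC hf, f, rfl⟩, hf⟩
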